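/- (Combinatorial form of the sorting-A+B theorem.) There is a universal constant C > 0 such that the following holds for all integers n ≥ 2. Let H ⊆ {−1,0,1}^{2n} be the set of vectors having exactly one +1 entry and one −1 entry among the first n coordinates and exactly one +1 entry and one −1 entry among the last n coordinates. Then for every x = (a₁,…,a_n,b₁,…,b_n) ∈ ℝ^{2n} there exists a subset S ⊆ H with |S| ≤ C·n·(log₂ n)² such that H ⊆ infer(S,x). In particular, the signs of ⟨x,h⟩ for h ∈ S ∪ (S−S) determine the answers to all comparisons a_i + b_j ≥ a_k + b_l (i,j,k,l ∈ [n]), i.e., they determine the sorted order of the sumset A+B where A = {a₁,…,a_n} and B = {b₁,…,b_n}. -/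

import Mathlib

open Finset

namespace LDT

/-- The standard inner product on `ℝ^n`. -/
def ip {n : ℕ} (x h : Fin n → ℝ) : ℝ := ∑ i, x i * h i

/-- `S` infers `h` at `x`: the sign of `⟨x,h⟩` is determined by the signs of `⟨x,v⟩` for
`v ∈ S ∪ (S - S)`, i.e. every `x'` with the same sign pattern as `x` on `S ∪ (S-S)` gives the
same sign on `h`. -/
def Infers {n : ℕ} (S : Finset (Fin n → ℝ)) (x h : Fin n → ℝ) : Prop :=
  ∀ x' : Fin n → ℝ,
    (∀ v ∈ S, SignType.sign (ip x' v) = SignType.sign (ip x v)) →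
    (∀ v ∈ S, ∀ w ∈ S, SignType.sign (ip x' (v - w)) = SignType.sign (ip x (v - w))) →
    SignType.sign (ip x' h) = SignType.sign (ip x h)

/-- `H` has inference dimension at most `d`: every subset `S ⊆ H` of size at least `d` contains,
for every `x`, an element `h` inferred by `S \ {h}` at `x`. -/
def InfProp {n : ℕ} (H : Finset (Fin n → ℝ)) (d : ℕ) : Prop :=
  ∀ S ⊆ H, d ≤ S.card → ∀ x : Fin n → ℝ, ∃ h ∈ S, Infers (S.erase h) x h

open scoped Classical

/-- The set `H ⊆ {-1,0,1}^(2n)` of vectors with exactly one `+1` and exactly one `-1` among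
the first `n` coordinates, and exactly one `+1` and exactly one `-1` among the last `n`
coordinates. Signs of `⟨x,h⟩` for `h ∈ H` encode all comparisons `aᵢ + bⱼ ≥ aₖ + bₗ` on the
sumset `A + B`, where `x = (a₁,…,aₙ,b₁,…,bₙ)`. -/
noncomputable def sumsetH (n : ℕ) : Finset (Fin (2 * n) → ℝ) :=
  (Fintype.piFinset (fun _ : Fin (2 * n) => ({-1, 0, 1} : Finset ℝ))).filter
    (fun h =>
      (Finset.univ.filter (fun t : Fin (2 * n) => (t : ℕ) < n ∧ h t = 1)).card = 1 ∧
      (Finset.univ.filter (fun t : Fin (2 * n) => (t : ℕ) < n ∧ h t = -1)).card = 1 ∧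
      (Finset.univ.filter (fun t : Fin (2 * n) => n ≤ (t : ℕ) ∧ h t = 1)).card = 1 ∧
      (Finset.univ.filter (fun t : Fin (2 * n) => n ≤ (t : ℕ) ∧ h t = -1)).card = 1)

lemma ip_eq_dotProduct {n : ℕ} (x h : Fin n → ℝ) : ip x h = x ⬝ᵥ h := rfl

lemma ip_neg_left {n : ℕ} (x h : Fin n → ℝ) : ip (-x) h = -ip x h := by
  simp [ip]

lemma Infers.mono {n : ℕ} {S T : Finset (Fin n → ℝ)} {x h : Fin n → ℝ} (hST : S ⊆ T)
    (hS : Infers S x h) : Infers T x h := fun x' h₁ h₂ =>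
  hS x' (fun v hv => h₁ v (hST hv)) (fun v hv w hw => h₂ v (hST hv) w (hST hw))

lemma Infers.of_mem {n : ℕ} {S : Finset (Fin n → ℝ)} {x h : Fin n → ℝ} (hS : h ∈ S) :
    Infers S x h := fun _ h₁ _ => h₁ h hS

lemma Infers.of_neg {n : ℕ} {S : Finset (Fin n → ℝ)} {x h : Fin n → ℝ}
    (hS : Infers S (-x) h) : Infers S x h := by
  intro x' h₁ h₂
  have := hS (-x')
    (fun v hv => by rw [ip_neg_left, ip_neg_left, Left.sign_neg, Left.sign_neg, h₁ v hv])
    (fun v hv w hw => by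
      rw [ip_neg_left, ip_neg_left, Left.sign_neg, Left.sign_neg, h₂ v hv w hw])
  rwa [ip_neg_left, ip_neg_left, Left.sign_neg, Left.sign_neg, neg_inj] at this

/-- The sign of a nonnegative combination of nonnegative reals depends only on the signs of the
summands. -/
lemma sign_sum_mul_eq {ι : Type*} (s : Finset ι) {c y z : ι → ℝ} (hc : ∀ i ∈ s, 0 ≤ c i)
    (hy : ∀ i ∈ s, 0 ≤ y i) (h : ∀ i ∈ s, SignType.sign (z i) = SignType.sign (y i)) :
    SignType.sign (∑ i ∈ s, c i * z i) = SignType.sign (∑ i ∈ s, c i * y i) := by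
  have hz : ∀ i ∈ s, 0 ≤ z i := fun i hi => by
    rw [← sign_nonneg_iff, h i hi, sign_nonneg_iff]; exact hy i hi
  have hzero : ∑ i ∈ s, c i * z i = 0 ↔ ∑ i ∈ s, c i * y i = 0 := by
    rw [sum_eq_zero_iff_of_nonneg fun i hi => mul_nonneg (hc i hi) (hz i hi),
      sum_eq_zero_iff_of_nonneg fun i hi => mul_nonneg (hc i hi) (hy i hi)]
    refine forall₂_congr fun i hi => ?_
    rw [mul_eq_zero, mul_eq_zero, ← sign_eq_zero_iff (a := z i), h i hi, sign_eq_zero_iff]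
  have hy' := sum_nonneg fun i hi => mul_nonneg (hc i hi) (hy i hi)
  have hz' := sum_nonneg fun i hi => mul_nonneg (hc i hi) (hz i hi)
  rcases hy'.eq_or_lt with h0 | h0
  · rw [← h0, hzero.2 h0.symm]
  · rw [sign_pos h0, sign_pos (hz'.lt_of_ne fun h1 => h0.ne' (hzero.1 h1.symm))]

/-- A finite set can be enumerated in increasing order of a real-valued function. -/
lemma exists_monotone_enum {α : Type*} {S : Finset α} {p : ℕ} (hS : S.card = p + 1)
    (f : α → ℝ) :
    ∃ g : ℕ → α, (∀ k, g k ∈ S) ∧ Set.InjOn g (Set.Iic p) ∧ Monotone fun k => f (g k) := by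
  let e : Fin (p + 1) ≃ S := (S.equivFinOfCardEq hS).symm
  let σ := Tuple.sort fun i => f (e i)
  have hmono : Monotone fun i => f (e (σ i)) := Tuple.monotone_sort fun i => f (e i)
  refine ⟨fun k => e (σ ⟨min k p, by omega⟩), fun k => (e _).2, fun a ha b hb hab => ?_,
    fun a b hab => hmono (Fin.mk_le_mk.2 (by omega))⟩
  have := σ.injective (e.injective (Subtype.ext hab))
  simp only [Fin.mk.injEq, Set.mem_Iic] at this ha hb
  omega

/-- Two distinct sets of steps of a sequence with the same sum express some step through the
earlier ones with coefficients in `{-1, 0, 1}`. -/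
lemma exists_step_eq {V : Type*} [AddCommGroup V] [Module ℝ V] {p : ℕ} (D : ℕ → V)
    {I J : Finset ℕ} (hI : I ⊆ range p) (hJ : J ⊆ range p) (hne : I ≠ J)
    (hsum : ∑ i ∈ I, D i = ∑ i ∈ J, D i) :
    ∃ q < p, ∃ a : ℕ → ℝ, (∀ i, -1 ≤ a i) ∧ D q = ∑ i ∈ range q, a i • D i := by
  have hsd : (symmDiff I J).Nonempty := by
    rw [nonempty_iff_ne_empty]
    exact fun h => hne (symmDiff_eq_bot.1 h)
  obtain ⟨q, hq, hmax⟩ := exists_max_image (symmDiff I J) id hsd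
  wlog hqI : q ∈ I ∧ q ∉ J generalizing I J
  · refine this hJ hI hne.symm hsum.symm (by rwa [symmDiff_comm]) (by rwa [symmDiff_comm])
      (by rwa [symmDiff_comm]) ?_
    exact (mem_symmDiff.1 hq).resolve_left hqI
  have hagree : ∀ i, q < i → (i ∈ I ↔ i ∈ J) := by
    intro i hi
    by_contra hcon
    have := hmax i (by rw [mem_symmDiff]; tauto)
    exact absurd this (not_le.2 hi)
  have hqp : q < p := mem_range.1 (hI hqI.1)
  let b : ℕ → ℝ := fun i => (if i ∈ J then 1 else 0) - (if i ∈ I then 1 else 0)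
  have hzero : ∑ i ∈ range p, b i • D i = 0 := by
    simp only [b, sub_smul, ite_smul, one_smul, zero_smul, sum_sub_distrib, sum_ite_mem,
      inter_eq_right.2 hI, inter_eq_right.2 hJ, hsum, sub_self]
  have htrunc : ∑ i ∈ range (q + 1), b i • D i = 0 := by
    rw [← hzero]
    refine sum_subset (range_mono hqp) fun i _ hi => ?_
    have : b i = 0 := by
      have := hagree i (by simpa using hi)
      simp [b, this]
    rw [this, zero_smul]
  refine ⟨q, hqp, b, fun i => ?_, ?_⟩
  · simp only [b]; split_ifs <;> norm_num
  · rw [sum_range_succ] at htrunc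
    have : b q = -1 := by simp [b, hqI.1, hqI.2]
    rw [this, neg_one_smul, add_neg_eq_zero] at htrunc
    exact htrunc.symm

/-- Among more than `(4 * p + 1) ^ N` sets of steps of a sequence in `{-1,0,1}^N`, two have the same
sum. -/
lemma exists_ne_sum_eq {N p : ℕ} (hp : (4 * p + 1) ^ N < 2 ^ p) {g : ℕ → Fin N → ℝ}
    (hg : ∀ k t, g k t = -1 ∨ g k t = 0 ∨ g k t = 1) :
    ∃ I ⊆ range p, ∃ J ⊆ range p, I ≠ J ∧
      ∑ i ∈ I, (g (i + 1) - g i) = ∑ i ∈ J, (g (i + 1) - g i) := by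
  have hz : ∀ k t, ∃ z : ℤ, g k t = z ∧ |z| ≤ 1 := by
    intro k t
    rcases hg k t with h | h | h
    · exact ⟨-1, by simp [h], by simp⟩
    · exact ⟨0, by simp [h], by simp⟩
    · exact ⟨1, by simp [h], by simp⟩
  choose z hzg hz1 using hz
  let F : Finset ℕ → Fin N → ℤ := fun I t => ∑ i ∈ I, (z (i + 1) t - z i t)
  have hmaps : ∀ I ∈ (range p).powerset,
      F I ∈ Fintype.piFinset fun _ : Fin N => Icc (-(2 * p : ℤ)) (2 * p) := by
    intro I hI
    rw [Fintype.mem_piFinset]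
    intro t
    rw [mem_Icc, ← abs_le]
    calc |F I t| ≤ ∑ i ∈ I, |z (i + 1) t - z i t| := abs_sum_le_sum_abs _ _
      _ ≤ ∑ i ∈ I, (2 : ℤ) := sum_le_sum fun i _ => by
          have h₁ := abs_le.1 (hz1 (i + 1) t)
          have h₂ := abs_le.1 (hz1 i t)
          rw [abs_le]
          omega
      _ ≤ 2 * p := by
          have := card_le_card (mem_powerset.1 hI)
          rw [card_range] at this
          rw [sum_const, nsmul_eq_mul]
          have : (I.card : ℤ) ≤ p := by exact_mod_cast this
          omega
  obtain ⟨I, hI, J, hJ, hne, hF⟩ := exists_ne_map_eq_of_card_lt_of_maps_to (by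
    rw [card_powerset, card_range, Fintype.card_piFinset, prod_const, card_univ,
      Fintype.card_fin, Int.card_Icc]
    convert hp using 2
    omega) hmaps
  refine ⟨I, mem_powerset.1 hI, J, mem_powerset.1 hJ, hne, ?_⟩
  ext t
  have := congrArg (fun a : ℤ => (a : ℝ)) (congrFun hF t)
  simpa [F, hzg] using this

lemma exists_infers_erase_of_nonneg {N p : ℕ} (hp : (4 * p + 1) ^ N < 2 ^ p)
    {S : Finset (Fin N → ℝ)} (hS : ∀ h ∈ S, ∀ t, h t = -1 ∨ h t = 0 ∨ h t = 1)
    (hcard : p + 1 ≤ S.card) {x : Fin N → ℝ} (hx : ∀ h ∈ S, 0 ≤ ip x h) :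
    ∃ h ∈ S, Infers (S.erase h) x h := by
  obtain ⟨S', hS'S, hS'⟩ := exists_subset_card_eq hcard
  obtain ⟨g, hgS', hinj, hmono⟩ := exists_monotone_enum hS' (ip x)
  have hgS : ∀ k, g k ∈ S := fun k => hS'S (hgS' k)
  obtain ⟨I, hI, J, hJ, hne, hsum⟩ := exists_ne_sum_eq hp fun k t => hS _ (hgS k) t
  obtain ⟨q, hqp, a, ha, hq⟩ := exists_step_eq _ hI hJ hne hsum
  refine ⟨g (q + 1), hgS _, fun x' h₁ h₂ => ?_⟩
  have hmem : ∀ i ≤ q, g i ∈ S.erase (g (q + 1)) := fun i hi =>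
    mem_erase.2 ⟨fun h => by
      have := hinj (show i ≤ p by omega) (show q + 1 ≤ p by omega) h
      omega, hgS i⟩
  have hexp : ∀ y : Fin N → ℝ,
      ip y (g (q + 1)) = ∑ i ∈ range (q + 1),
        (if i = 0 then 1 else 1 + a (i - 1)) *
          (if i = 0 then ip y (g 0) else ip y (g i - g (i - 1))) := by
    intro y
    have htel : g (q + 1) = g 0 + ∑ i ∈ range q, (1 + a i) • (g (i + 1) - g i) := by
      simp only [add_smul, one_smul, sum_add_distrib, ← hq, sum_range_sub]
      abel
    rw [sum_range_succ', htel]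
    simp only [ip_eq_dotProduct, dotProduct_add, dotProduct_sum, dotProduct_smul, smul_eq_mul]
    simp [add_comm]
  rw [hexp x', hexp x]
  refine sign_sum_mul_eq _ (fun i _ => ?_) (fun i _ => ?_) (fun i hi => ?_)
  · split_ifs
    · exact zero_le_one
    · linarith [ha (i - 1)]
  · split_ifs
    · exact hx _ (hgS 0)
    · rw [ip_eq_dotProduct, dotProduct_sub, sub_nonneg]
      exact hmono (Nat.sub_le i 1)
  · have hi' : i ≤ q := Nat.lt_succ_iff.1 (mem_range.1 hi)
    split_ifs
    · exact h₁ _ (hmem 0 (Nat.zero_le q))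
    · exact h₂ _ (hmem i hi') _ (hmem (i - 1) (by omega))

lemma infProp_of_forall_mem {N p : ℕ} (hp : (4 * p + 1) ^ N < 2 ^ p)
    {H : Finset (Fin N → ℝ)} (hH : ∀ h ∈ H, ∀ t, h t = -1 ∨ h t = 0 ∨ h t = 1) :
    InfProp H (2 * (p + 1)) := by
  intro S hS hcard x
  have hsplit : S.card ≤ (S.filter fun h => 0 ≤ ip x h).card +
      (S.filter fun h => 0 ≤ ip (-x) h).card := by
    refine (card_le_card fun h hh => ?_).trans (card_union_le _ _)
    simp only [mem_union, mem_filter, hh, true_and, ip_neg_left, neg_nonneg]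
    exact le_total _ _
  have hcase : ∀ y : Fin N → ℝ, p + 1 ≤ (S.filter fun h => 0 ≤ ip y h).card →
      ∃ h ∈ S, Infers (S.erase h) y h := by
    intro y hy
    obtain ⟨h, hh, hinf⟩ := exists_infers_erase_of_nonneg hp
      (fun h hh => hH h (hS (mem_of_mem_filter h hh))) hy fun h hh => (mem_filter.1 hh).2
    exact ⟨h, mem_of_mem_filter h hh, hinf.mono (erase_subset_erase _ (filter_subset _ _))⟩
  rcases le_or_gt (p + 1) (S.filter fun h => 0 ≤ ip x h).card with h | h
  · exact hcase x h
  · obtain ⟨h, hh, hinf⟩ := hcase (-x) (by omega)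
    exact ⟨h, hh, hinf.of_neg⟩

lemma card_filter_not_infers_erase_le {N d : ℕ} {H T : Finset (Fin N → ℝ)}
    (hH : InfProp H d) (hT : T ⊆ H) (x : Fin N → ℝ) :
    (T.filter fun h => ¬ Infers (T.erase h) x h).card ≤ d := by
  by_contra! hlt
  obtain ⟨h, hh, hinf⟩ := hH _ ((filter_subset _ _).trans hT) hlt.le x
  exact (mem_filter.1 hh).2 (hinf.mono (erase_subset_erase _ (filter_subset _ _)))

/-- Double counting over all subsets of size `2 * d`: some set of at most `2 * d` elements
infers at least half of the given family. -/
lemma exists_infers_half {N d : ℕ} {H : Finset (Fin N → ℝ)} (hH : InfProp H d)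
    (x : Fin N → ℝ) :
    ∃ T ⊆ H, T.card ≤ 2 * d ∧ 2 * (H.filter fun h => ¬ Infers T x h).card ≤ H.card := by
  rcases le_or_gt H.card (2 * d) with hle | hgt
  · refine ⟨H, subset_rfl, hle, ?_⟩
    rw [filter_false_of_mem fun h hh => not_not.2 (Infers.of_mem hh)]
    simp
  obtain ⟨k, hk⟩ : ∃ k, 2 * d = k + 1 := by
    refine Nat.exists_eq_succ_of_ne_zero fun h0 => ?_
    obtain ⟨h, hh, -⟩ := hH ∅ (empty_subset _) (by simp; omega) x
    exact absurd hh (notMem_empty h)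
  by_contra! hcon
  have hcount : ∑ T ∈ H.powersetCard k, (H.filter fun h => ¬ Infers T x h).card ≤
      ∑ T ∈ H.powersetCard (k + 1), (T.filter fun h => ¬ Infers (T.erase h) x h).card := by
    rw [← card_sigma, ← card_sigma]
    have hnot : ∀ {T : Finset (Fin N → ℝ)} {h}, ¬ Infers T x h → h ∉ T :=
      fun hn hm => hn (Infers.of_mem hm)
    refine card_le_card_of_injOn
      (fun a : (_ : Finset (Fin N → ℝ)) × (Fin N → ℝ) => ⟨insert a.2 a.1, a.2⟩) ?_ ?_
    · rintro ⟨T, h⟩ hTh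
      simp only [coe_sigma, Set.mem_sigma_iff, mem_coe, mem_powersetCard, mem_filter] at hTh ⊢
      obtain ⟨⟨hTH, hTk⟩, hhH, hn⟩ := hTh
      refine ⟨⟨insert_subset hhH hTH, ?_⟩, mem_insert_self _ _, ?_⟩
      · rw [card_insert_of_notMem (hnot hn), hTk]
      · rwa [erase_insert (hnot hn)]
    · rintro ⟨T, h⟩ hTh ⟨T', h'⟩ hTh' heq
      simp only [coe_sigma, Set.mem_sigma_iff, mem_coe, mem_filter] at hTh hTh'
      simp only [Sigma.mk.injEq, heq_eq_eq] at heq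
      obtain ⟨hins, rfl⟩ := heq
      rw [← erase_insert (hnot hTh.2.2), hins, erase_insert (hnot hTh'.2.2)]
  have hupper : ∑ T ∈ H.powersetCard (k + 1),
      (T.filter fun h => ¬ Infers (T.erase h) x h).card ≤ H.card.choose (k + 1) * d := by
    refine (sum_le_card_nsmul _ _ d fun T hT => ?_).trans_eq (by simp)
    exact card_filter_not_infers_erase_le hH (mem_powersetCard.1 hT).1 x
  have hlower : H.card.choose k * (H.card + 1) ≤
      2 * ∑ T ∈ H.powersetCard k, (H.filter fun h => ¬ Infers T x h).card := by
    rw [mul_sum, ← card_powersetCard, ← smul_eq_mul]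
    refine card_nsmul_le_sum _ _ _ fun T hT => ?_
    obtain ⟨hTH, hTk⟩ := mem_powersetCard.1 hT
    exact hcon T hTH (by omega)
  have hchoose := Nat.choose_succ_right_eq H.card k
  have hpos : 0 < H.card.choose k := Nat.choose_pos (by omega)
  have hfinal : H.card.choose k * (H.card + 1) ≤ H.card.choose k * (H.card - k) := by
    calc H.card.choose k * (H.card + 1) ≤ H.card.choose (k + 1) * (2 * d) := by linarith
      _ = H.card.choose k * (H.card - k) := by rw [hk, hchoose]
  have := Nat.le_of_mul_le_mul_left hfinal hpos
  omega

lemma InfProp.mono {N d : ℕ} {H H' : Finset (Fin N → ℝ)} (hH : InfProp H d) (hsub : H' ⊆ H) :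
    InfProp H' d := fun S hS => hH S (hS.trans hsub)

lemma exists_infers_all {N d : ℕ} (x : Fin N → ℝ) (k : ℕ) {H : Finset (Fin N → ℝ)}
    (hH : InfProp H d) (hcard : H.card < 2 ^ k) :
    ∃ S ⊆ H, S.card ≤ 2 * d * k ∧ ∀ h ∈ H, Infers S x h := by
  induction k generalizing H with
  | zero =>
    have : H = ∅ := by simpa using hcard
    exact ⟨∅, empty_subset _, by simp, by simp [this]⟩
  | succ k ih =>
    obtain ⟨T, hTH, hT, hhalf⟩ := exists_infers_half hH x
    obtain ⟨S, hS, hScard, hSinf⟩ := ih (H := H.filter fun h => ¬ Infers T x h)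
      (hH.mono (filter_subset _ _)) (by rw [pow_succ] at hcard; omega)
    refine ⟨T ∪ S, union_subset hTH (hS.trans (filter_subset _ _)), ?_, fun h hh => ?_⟩
    · have := card_union_le T S
      rw [mul_add_one]
      omega
    · by_cases hTh : Infers T x h
      · exact hTh.mono subset_union_left
      · exact (hSinf h (mem_filter.2 ⟨hh, hTh⟩)).mono subset_union_right

lemma eq_or_of_mem_sumsetH {n : ℕ} {h : Fin (2 * n) → ℝ} (hh : h ∈ sumsetH n)
    (t : Fin (2 * n)) : h t = -1 ∨ h t = 0 ∨ h t = 1 := by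
  simpa using Fintype.mem_piFinset.1 (mem_filter.1 hh).1 t

lemma card_sumsetH_le (n : ℕ) : (sumsetH n).card ≤ (2 * n) ^ 4 := by
  let F : Fin (2 * n) × Fin (2 * n) × Fin (2 * n) × Fin (2 * n) → Fin (2 * n) → ℝ :=
    fun a t => if t = a.1 ∨ t = a.2.2.1 then 1 else if t = a.2.1 ∨ t = a.2.2.2 then -1 else 0
  have hsub : sumsetH n ⊆ univ.image F := by
    intro h hh
    have hval := eq_or_of_mem_sumsetH hh
    obtain ⟨-, h₁, h₂, h₃, h₄⟩ := mem_filter.1 hh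
    obtain ⟨i, hi⟩ := card_eq_one.1 h₁
    obtain ⟨j, hj⟩ := card_eq_one.1 h₂
    obtain ⟨k, hk⟩ := card_eq_one.1 h₃
    obtain ⟨l, hl⟩ := card_eq_one.1 h₄
    refine mem_image.2 ⟨(i, j, k, l), mem_univ _, funext fun t => ?_⟩
    have hi := Finset.ext_iff.1 hi t
    have hj := Finset.ext_iff.1 hj t
    have hk := Finset.ext_iff.1 hk t
    have hl := Finset.ext_iff.1 hl t
    simp only [mem_filter, mem_univ, true_and, mem_singleton] at hi hj hk hl
    have hpos : h t = 1 ↔ t = i ∨ t = k := by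
      rw [← hi, ← hk, ← or_and_right]
      simp [lt_or_ge]
    have hneg : h t = -1 ↔ t = j ∨ t = l := by
      rw [← hj, ← hl, ← or_and_right]
      simp [lt_or_ge]
    simp only [F, ← hpos, ← hneg]
    rcases hval t with h | h | h <;> norm_num [h]
  refine (card_le_card hsub).trans (card_image_le.trans_eq ?_)
  simp only [card_univ, Fintype.card_prod, Fintype.card_fin]
  ring

lemma box_card_lt_two_pow {n L : ℕ} (hn : 0 < n) (hL : 1 ≤ L) (hlt : n < 2 ^ (L + 1)) :
    (4 * (32 * n * L) + 1) ^ (2 * n) < 2 ^ (32 * n * L) := by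
  have hnL : 0 < n * L := Nat.mul_pos hn hL
  have hbase : 4 * (32 * n * L) + 1 ≤ 2 ^ (11 * L) := by
    calc 4 * (32 * n * L) + 1 ≤ 2 ^ 8 * (n * L) := by linarith
      _ ≤ 2 ^ 8 * (2 ^ (L + 1) * 2 ^ L) := by
          gcongr
          exact Nat.lt_two_pow_self.le
      _ = 2 ^ (2 * L + 9) := by ring
      _ ≤ 2 ^ (11 * L) := Nat.pow_le_pow_right two_pos (by omega)
  calc (4 * (32 * n * L) + 1) ^ (2 * n) ≤ (2 ^ (11 * L)) ^ (2 * n) := by gcongr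
    _ = 2 ^ (22 * (n * L)) := by rw [← pow_mul]; ring
    _ < 2 ^ (32 * n * L) := Nat.pow_lt_pow_right one_lt_two (by linarith)

/-- Theorem 1.2, combinatorial form: there is a universal constant `C > 0`
such that for every `n ≥ 2` and every `x ∈ ℝ^(2n)` there is `S ⊆ H` with `|S| ≤ C·n·(log₂ n)²`
such that `S` infers every `h ∈ H` at `x`, i.e. the signs of `⟨x,h⟩` for `h ∈ S ∪ (S-S)`
determine all the comparisons `aᵢ + bⱼ ≥ aₖ + bₗ`, hence the sorted order of `A + B`. -/
theorem sortAB_combinatorial :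
    ∃ C : ℝ, 0 < C ∧ ∀ n : ℕ, 2 ≤ n →
      ∀ x : Fin (2 * n) → ℝ,
        ∃ S ⊆ sumsetH n,
          ((S.card : ℝ) ≤ C * n * (Real.logb 2 n) ^ 2) ∧
          ∀ h ∈ sumsetH n, Infers S x h := by
  refine ⟨6144, by norm_num, fun n hn x => ?_⟩
  set L := Nat.log 2 n with hLdef
  have hL : 1 ≤ L := Nat.log_pos one_lt_two hn
  have hlt : n < 2 ^ (L + 1) := Nat.lt_pow_succ_log_self one_lt_two n
  have hinf : InfProp (sumsetH n) (2 * (32 * n * L + 1)) :=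
    infProp_of_forall_mem (box_card_lt_two_pow (by omega) hL hlt) fun h => eq_or_of_mem_sumsetH
  have hcard : (sumsetH n).card < 2 ^ (12 * L) := by
    calc (sumsetH n).card ≤ (2 * n) ^ 4 := card_sumsetH_le n
      _ < (2 * 2 ^ (L + 1)) ^ 4 := by gcongr
      _ = 2 ^ (4 * L + 8) := by ring
      _ ≤ 2 ^ (12 * L) := Nat.pow_le_pow_right two_pos (by omega)
  obtain ⟨S, hS, hScard, hSinf⟩ := exists_infers_all x (12 * L) hinf hcard
  refine ⟨S, hS, ?_, hSinf⟩
  have hlog : (L : ℝ) ≤ Real.logb 2 n := Real.natLog_le_logb n 2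
  have hnL : 1 ≤ n * L := Nat.mul_pos (by omega) hL
  have hbound : S.card ≤ 6144 * n * L ^ 2 := by
    calc S.card ≤ 2 * (2 * (32 * n * L + 1)) * (12 * L) := hScard
      _ ≤ 2 * (2 * (64 * (n * L))) * (12 * L) := by gcongr; linarith
      _ ≤ 6144 * n * L ^ 2 := by nlinarith
  calc (S.card : ℝ) ≤ 6144 * n * (L : ℝ) ^ 2 := by exact_mod_cast hbound
    _ ≤ 6144 * n * Real.logb 2 n ^ 2 := by gcongr

end LDT
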